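/- Let v : Ω̄×[0,T] → ℝ² be smooth. Then ‖∂_t Dv(t)‖_{L^∞(Ω)} ≤ C E(t,v)^{1/2} for every t ∈ [0,T], with C depending only on Ω, C₁, C₂. -/

import Mathlib

open MeasureTheory Real Filter

noncomputable section

/-- The reference domain `Ω = 𝕋 × (0,1)`, realized as the fundamental square `(0,1) × (0,1)`. -/
def Oset : Set (ℝ × ℝ) := Set.Ioo (0:ℝ) 1 ×ˢ Set.Ioo (0:ℝ) 1

/-- The vacuum boundary `Γ = 𝕋 × {0,1}`. -/
def Gset : Set (ℝ × ℝ) := {x : ℝ × ℝ | x.2 = 0 ∨ x.2 = 1}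

/-- Distance to the boundary `Γ`. -/
def distG (x : ℝ × ℝ) : ℝ := min x.2 (1 - x.2)

variable {F : Type*} [NormedAddCommGroup F] [NormedSpace ℝ F]

/-- Horizontal partial derivative `∂₁`. -/
def pd1 (f : ℝ × ℝ → F) : ℝ × ℝ → F := fun x => fderiv ℝ f x (1, 0)

/-- Vertical (normal) partial derivative `∂₂`. -/
def pd2 (f : ℝ × ℝ → F) : ℝ × ℝ → F := fun x => fderiv ℝ f x (0, 1)

/-- Time derivative `∂ₜ`. -/
def pdt (v : ℝ → ℝ × ℝ → F) : ℝ → ℝ × ℝ → F := fun t x => deriv (fun s => v s x) t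

/-- `|Df|²` at a point. -/
def gradSq (f : ℝ × ℝ → F) (x : ℝ × ℝ) : ℝ := ‖pd1 f x‖ ^ 2 + ‖pd2 f x‖ ^ 2

/-- 1-periodicity in the horizontal variable (functions on the torus `𝕋 × (0,1)`). -/
def Per (f : ℝ × ℝ → F) : Prop := ∀ x : ℝ × ℝ, f (x.1 + 1, x.2) = f x

/-- Smoothness. -/
def SmoothFn (f : ℝ × ℝ → F) : Prop := ∀ n : ℕ, ContDiff ℝ n f

/-- Joint smoothness of a time dependent family. -/
def SmoothT (v : ℝ → ℝ × ℝ → F) : Prop :=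
  ∀ n : ℕ, ContDiff ℝ n (fun p : ℝ × (ℝ × ℝ) => v p.1 p.2)

def PerT (v : ℝ → ℝ × ℝ → F) : Prop := ∀ t : ℝ, Per (v t)

/-- Admissible initial depth profile: smooth, periodic, vanishing on `Γ` and
comparable to the distance to the boundary. -/
def IsDensity (C₁ C₂ : ℝ) (ρ₀ : ℝ × ℝ → ℝ) : Prop :=
  SmoothFn ρ₀ ∧ Per ρ₀ ∧ (∀ x ∈ Gset, ρ₀ x = 0) ∧
    ∀ x ∈ Oset, C₁ * distG x ≤ ρ₀ x ∧ ρ₀ x ≤ C₂ * distG x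

/-- The higher-order energy functional `E(t,v)`. -/
def energy (ρ₀ : ℝ × ℝ → ℝ) (v : ℝ → ℝ × ℝ → ℝ × ℝ) (t : ℝ) : ℝ :=
  (∑ l₀ ∈ Finset.range 5, ∫ x in Oset, ρ₀ x * ‖(pdt^[l₀] v) t x‖ ^ 2)
    + (∑ l₀ ∈ Finset.range 4, ∑ l₁ ∈ Finset.range (7 - 2 * l₀),
        ∫ x in Oset, ρ₀ x *
          (gradSq (pd1^[l₁] ((pdt^[l₀] v) t)) x + gradSq (pd1^[l₁ + 1] ((pdt^[l₀] v) t)) x))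
    + ∑ l₀ ∈ Finset.range 4, ∑ l₁ ∈ Finset.range (7 - 2 * l₀),
        ∑ l₂ ∈ Finset.Icc 2 (8 - 2 * l₀ - l₁),
          ∫ x in Oset, ρ₀ x ^ l₂ * ‖(pd1^[l₁] (pd2^[l₂] ((pdt^[l₀] v) t))) x‖ ^ 2

/-- The Lagrangian flow map `η(x,t) = x + ∫₀ᵗ v(x,s) ds`. -/
def flowMap (v : ℝ → ℝ × ℝ → ℝ × ℝ) (t : ℝ) (x : ℝ × ℝ) : ℝ × ℝ :=
  x + ∫ s in (0:ℝ)..t, v s x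

/-- The (squared-sum) Sobolev `H^k(Ω)` norm. -/
def sobolevNorm (k : ℕ) (f : ℝ × ℝ → F) : ℝ :=
  Real.sqrt (∑ θ ∈ Finset.range (k + 1), ∫ x in Oset, ‖iteratedFDeriv ℝ θ f x‖ ^ 2)

/-- `sup_{0 ≤ s ≤ t} E(s,v)^{1/2}`. -/
def supEn (ρ₀ : ℝ × ℝ → ℝ) (v : ℝ → ℝ × ℝ → ℝ × ℝ) (t : ℝ) : ℝ :=
  ⨆ s : Set.Icc (0:ℝ) t, Real.sqrt (energy ρ₀ v ↑s)

/-- Weighted `L²(Ω)` norm `‖ρ₀^p ∂₁^{l₁} D^k f‖_{L²(Ω)}`. -/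
def wL2 (ρ₀ : ℝ × ℝ → ℝ) (p k l₁ : ℕ) (f : ℝ × ℝ → F) : ℝ :=
  Real.sqrt (∫ x in Oset, (ρ₀ x ^ p * ‖iteratedFDeriv ℝ k (pd1^[l₁] f) x‖) ^ 2)

/-- Weighted `L^∞(Ω)` norm `‖ρ₀^p ∂₁^{l₁} D^k f‖_{L^∞(Ω)}`. -/
def wSup (ρ₀ : ℝ × ℝ → ℝ) (p k l₁ : ℕ) (f : ℝ × ℝ → F) : ℝ :=
  ⨆ x : Oset, ρ₀ (x : ℝ × ℝ) ^ p * ‖iteratedFDeriv ℝ k (pd1^[l₁] f) (x : ℝ × ℝ)‖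

def pick (i : Fin 2) (w : ℝ × ℝ) : ℝ := if i = 0 then w.1 else w.2

def evec (k : Fin 2) : ℝ × ℝ := if k = 0 then (1, 0) else (0, 1)

def pdk (k : Fin 2) (f : ℝ × ℝ → ℝ) : ℝ × ℝ → ℝ := fun x => fderiv ℝ f x (evec k)

/-- The cofactor matrix `a` of `Dη`, `a = [[∂₂η², −∂₂η¹], [−∂₁η², ∂₁η¹]]`,
indexed so that `cof η x i k = a_i^k`. -/
def cof (η : ℝ × ℝ → ℝ × ℝ) (x : ℝ × ℝ) (i k : Fin 2) : ℝ :=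
  if i = 0 then
    (if k = 0 then pd2 (fun y => (η y).2) x else -pd1 (fun y => (η y).2) x)
  else
    (if k = 0 then -pd2 (fun y => (η y).1) x else pd1 (fun y => (η y).1) x)

/-- The Jacobian determinant `J = det Dη`. -/
def jac (η : ℝ × ℝ → ℝ × ℝ) (x : ℝ × ℝ) : ℝ :=
  pd1 (fun y => (η y).1) x * pd2 (fun y => (η y).2) x
    - pd2 (fun y => (η y).1) x * pd1 (fun y => (η y).2) x

/-- `b^{kj} = a_l^k a_l^j`. -/
def bmat (η : ℝ × ℝ → ℝ × ℝ) (x : ℝ × ℝ) (k j : Fin 2) : ℝ :=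
  ∑ l : Fin 2, cof η x l k * cof η x l j

/-- `(v,η)` is a (classical) solution of the Lagrangian system
`ρ₀ ∂ₜ v^i + (ρ₀² J⁻² a_i^k),_k = (ρ₀ J⁻² b^{kj} v^i,_j),_k` in `Ω × (0,T]`. -/
def IsLagSol (ρ₀ : ℝ × ℝ → ℝ) (v : ℝ → ℝ × ℝ → ℝ × ℝ) (T : ℝ) : Prop :=
  ∀ t : ℝ, 0 < t → t ≤ T → ∀ x ∈ Oset, ∀ i : Fin 2,
    ρ₀ x * pick i (pdt v t x)
        + ∑ k : Fin 2, pdk k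
            (fun y => ρ₀ y ^ 2 * jac (flowMap v t) y ^ (-2 : ℤ) * cof (flowMap v t) y i k) x
      = ∑ k : Fin 2, pdk k
          (fun y => ρ₀ y * jac (flowMap v t) y ^ (-2 : ℤ) *
            ∑ j : Fin 2, bmat (flowMap v t) y k j * pdk j (fun z => pick i (v t z)) y) x

/-- The a priori assumption: `sup_{0≤t≤T} E(t,v) ≤ M₁`,
`T ∈ (0, 1/(20c₁c₂√M₁ + 10c₁²c₂²M₁)] ∩ (0,1)`, where `c₁, c₂` are the constants of the
embedding inequalities, so that in particular `‖Dv‖_{L^∞} ≤ c₁c₂ E^{1/2}`. -/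
def Apriori (ρ₀ : ℝ × ℝ → ℝ) (v : ℝ → ℝ × ℝ → ℝ × ℝ) (T M₁ c₁ c₂ : ℝ) : Prop :=
  0 < c₁ ∧ 0 < c₂ ∧ 0 ≤ M₁ ∧ 0 < T ∧ T ≤ 1 ∧
    T ≤ 1 / (20 * c₁ * c₂ * Real.sqrt M₁ + 10 * c₁ ^ 2 * c₂ ^ 2 * M₁) ∧
    (∀ t ∈ Set.Icc (0:ℝ) T, energy ρ₀ v t ≤ M₁) ∧
    ∀ t ∈ Set.Icc (0:ℝ) T, ∀ x ∈ Oset,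
      ‖fderiv ℝ (v t) x‖ ≤ c₁ * c₂ * Real.sqrt (energy ρ₀ v t)

/-- Smooth test functions compactly supported in `Ω`. -/
def CinfTest (φ : ℝ × ℝ → ℝ) : Prop :=
  (∀ n : ℕ, ContDiff ℝ n φ) ∧ HasCompactSupport φ ∧ tsupport φ ⊆ Oset

/-- `g` is the weak directional derivative of `u` in direction `e` on `Ω`. -/
def WeakPD (e : ℝ × ℝ) (u g : ℝ × ℝ → ℝ) : Prop :=
  ∀ φ : ℝ × ℝ → ℝ, CinfTest φ →
    ∫ x in Oset, u x * fderiv ℝ φ x e = -∫ x in Oset, g x * φ x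

/-- Membership in the weighted space `H¹_{ρ₀}(Ω)`, with weak gradient `Dw`. -/
def InH1w (ρ₀ : ℝ × ℝ → ℝ) (w : ℝ × ℝ → ℝ) (Dw : ℝ × ℝ → ℝ × ℝ) : Prop :=
  AEStronglyMeasurable w (volume.restrict Oset) ∧
    AEStronglyMeasurable Dw (volume.restrict Oset) ∧
    IntegrableOn (fun x => ρ₀ x * (w x) ^ 2) Oset ∧
    IntegrableOn (fun x => ρ₀ x * ‖Dw x‖ ^ 2) Oset ∧
    WeakPD (1, 0) w (fun x => (Dw x).1) ∧ WeakPD (0, 1) w (fun x => (Dw x).2)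

/-- The bilinear form `B[w,φ]_μ = ∫_Ω ρ₀ (Dw·Dφ + wφ) dx`. -/
def Bform (ρ₀ : ℝ × ℝ → ℝ) (w : ℝ × ℝ → ℝ) (Dw : ℝ × ℝ → ℝ × ℝ)
    (φ : ℝ × ℝ → ℝ) (Dφ : ℝ × ℝ → ℝ × ℝ) : ℝ :=
  ∫ x in Oset, ρ₀ x * ((Dw x).1 * (Dφ x).1 + (Dw x).2 * (Dφ x).2 + w x * φ x)

section Helpers
open scoped ContDiff

lemma cd_pd1 {f : ℝ × ℝ → F} (hf : ContDiff ℝ ∞ f) : ContDiff ℝ ∞ (pd1 f) :=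
  (hf.fderiv_right (m := ∞) (by simp)).clm_apply contDiff_const

lemma cd_pd2 {f : ℝ × ℝ → F} (hf : ContDiff ℝ ∞ f) : ContDiff ℝ ∞ (pd2 f) :=
  (hf.fderiv_right (m := ∞) (by simp)).clm_apply contDiff_const

lemma cd_pd1_iter {f : ℝ × ℝ → F} (hf : ContDiff ℝ ∞ f) (k : ℕ) :
    ContDiff ℝ ∞ (pd1^[k] f) := by
  induction k with
  | zero => exact hf
  | succ k ih => rw [Function.iterate_succ_apply']; exact cd_pd1 ih

lemma cd_pd2_iter {f : ℝ × ℝ → F} (hf : ContDiff ℝ ∞ f) (k : ℕ) :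
    ContDiff ℝ ∞ (pd2^[k] f) := by
  induction k with
  | zero => exact hf
  | succ k ih => rw [Function.iterate_succ_apply']; exact cd_pd2 ih

lemma pd_comm {f : ℝ × ℝ → F} (hf : ContDiff ℝ ∞ f) : pd2 (pd1 f) = pd1 (pd2 f) := by
  funext x
  have hd : DifferentiableAt ℝ (fderiv ℝ f) x :=
    (hf.fderiv_right (m := ∞) (by simp)).differentiable (by simp) x
  have hs : IsSymmSndFDerivAt ℝ f x := hf.contDiffAt.isSymmSndFDerivAt (by
    rw [minSmoothness_of_isRCLikeNormedField]; exact WithTop.coe_le_coe.2 (le_top : (2 : ℕ∞) ≤ ⊤))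
  change fderiv ℝ (fun y => fderiv ℝ f y (1, 0)) x (0, 1) =
    fderiv ℝ (fun y => fderiv ℝ f y (0, 1)) x (1, 0)
  rw [fderiv_clm_apply hd (differentiableAt_const _),
    fderiv_clm_apply hd (differentiableAt_const _)]
  simpa using hs (0, 1) (1, 0)

lemma pd_comm_iter {f : ℝ × ℝ → F} (hf : ContDiff ℝ ∞ f) (k : ℕ) :
    pd2 (pd1^[k] f) = pd1^[k] (pd2 f) := by
  induction k with
  | zero => rfl
  | succ k ih =>
    rw [Function.iterate_succ_apply', Function.iterate_succ_apply',
      pd_comm (cd_pd1_iter hf k), ih]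

lemma hasDeriv_x {f : ℝ × ℝ → F} (hf : ContDiff ℝ ∞ f) (x y : ℝ) :
    HasDerivAt (fun s => f (s, y)) (pd1 f (x, y)) x := by
  have h1 : HasFDerivAt f (fderiv ℝ f (x, y)) (x, y) :=
    (hf.differentiable (by simp) _).hasFDerivAt
  have h2 : HasDerivAt (fun s : ℝ => (s, y)) ((1 : ℝ), (0 : ℝ)) x :=
    (hasDerivAt_id x).prodMk (hasDerivAt_const x y)
  exact h1.comp_hasDerivAt x h2

lemma hasDeriv_y {f : ℝ × ℝ → F} (hf : ContDiff ℝ ∞ f) (x y : ℝ) :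
    HasDerivAt (fun s => f (x, s)) (pd2 f (x, y)) y := by
  have h1 : HasFDerivAt f (fderiv ℝ f (x, y)) (x, y) :=
    (hf.differentiable (by simp) _).hasFDerivAt
  have h2 : HasDerivAt (fun s : ℝ => (x, s)) ((0 : ℝ), (1 : ℝ)) y :=
    (hasDerivAt_const y x).prodMk (hasDerivAt_id y)
  exact h1.comp_hasDerivAt y h2

/-- integrals over the square as iterated interval integrals -/
lemma intO {f : ℝ × ℝ → ℝ} (hf : Continuous f) :
    ∫ x in Oset, f x = ∫ x in (0:ℝ)..1, ∫ y in (0:ℝ)..1, f (x, y) := by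
  have hi : IntegrableOn f (Set.Ioo (0:ℝ) 1 ×ˢ Set.Ioo (0:ℝ) 1) (volume.prod volume) := by
    apply (hf.continuousOn.integrableOn_compact
      (isCompact_Icc.prod isCompact_Icc : IsCompact (Set.Icc (0:ℝ) 1 ×ˢ Set.Icc (0:ℝ) 1))).mono_set
    exact Set.prod_mono Set.Ioo_subset_Icc_self Set.Ioo_subset_Icc_self
  rw [Oset, Measure.volume_eq_prod, setIntegral_prod _ hi]
  simp only [intervalIntegral.integral_of_le zero_le_one, integral_Ioc_eq_integral_Ioo]

lemma intgO {f : ℝ × ℝ → ℝ} (hf : Continuous f) : IntegrableOn f Oset := by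
  apply (hf.continuousOn.integrableOn_compact
    (isCompact_Icc.prod isCompact_Icc : IsCompact (Set.Icc (0:ℝ) 1 ×ˢ Set.Icc (0:ℝ) 1))).mono_set
  exact Set.prod_mono Set.Ioo_subset_Icc_self Set.Ioo_subset_Icc_self

lemma measO : MeasurableSet Oset := measurableSet_Ioo.prod measurableSet_Ioo

lemma cont_inner {f : ℝ × ℝ → ℝ} (hf : Continuous f) :
    Continuous fun x : ℝ => ∫ y in (0:ℝ)..1, f (x, y) :=
  intervalIntegral.continuous_parametric_intervalIntegral_of_continuous' (by fun_prop) 0 1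

/-- one-dimensional Hardy inequality -/
lemma hardy1 (a : ℕ) (ha : a ≤ 2) {g g' : ℝ → ℝ} (hg : ∀ y, HasDerivAt g (g' y) y)
    (hg' : Continuous g') :
    ∫ y in (0:ℝ)..1, (y * (1 - y)) ^ a * g y ^ 2 ≤
      ∫ y in (0:ℝ)..1, 400 * ((y * (1 - y)) ^ (a + 2) * g y ^ 2
        + (y * (1 - y)) ^ (a + 2) * g' y ^ 2) := by
  have hgc : Continuous g := continuous_iff_continuousAt.2 fun y => (hg y).continuousAt
  set φ' : ℝ → ℝ := fun y =>
    (((a:ℝ) + 1) * (y * (1 - y)) ^ a - (4 * a + 6) * (y * (1 - y)) ^ (a + 1)) * g y ^ 2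
      + (y * (1 - y)) ^ (a + 1) * (1 - 2 * y) * (2 * g y * g' y) with hφ'
  have hder : ∀ y, HasDerivAt (fun y => (y * (1 - y)) ^ (a + 1) * (1 - 2 * y) * g y ^ 2)
      (φ' y) y := by
    intro y
    have h1 : HasDerivAt (fun y : ℝ => y * (1 - y)) (1 * (1 - y) + y * (0 - 1)) y :=
      (hasDerivAt_id y).mul ((hasDerivAt_const y (1:ℝ)).sub (hasDerivAt_id y))
    have h2 := h1.pow (a + 1)
    have h3 : HasDerivAt (fun y : ℝ => 1 - 2 * y) (0 - 2 * 1) y :=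
      (hasDerivAt_const y (1:ℝ)).sub ((hasDerivAt_id y).const_mul 2)
    have h4 := (h2.mul h3).mul ((hg y).pow 2)
    refine h4.congr_deriv ?_
    simp only [hφ', Nat.add_sub_cancel, Pi.mul_apply, Pi.pow_apply]
    push_cast
    ring
  have hφc : Continuous φ' := by fun_prop
  have hzero : ∫ y in (0:ℝ)..1, φ' y = 0 := by
    rw [intervalIntegral.integral_eq_sub_of_hasDerivAt (fun y _ => hder y)
      (hφc.intervalIntegrable _ _)]
    simp
  have key : ∫ y in (0:ℝ)..1, ((y * (1 - y)) ^ a * g y ^ 2 - 2 * φ' y) ≤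
      ∫ y in (0:ℝ)..1, 400 * ((y * (1 - y)) ^ (a + 2) * g y ^ 2
        + (y * (1 - y)) ^ (a + 2) * g' y ^ 2) := by
    apply intervalIntegral.integral_mono_on zero_le_one
    · exact (by fun_prop : Continuous _).intervalIntegrable _ _
    · exact (by fun_prop : Continuous _).intervalIntegrable _ _
    · intro y hy
      have hθ0 : 0 ≤ y * (1 - y) := mul_nonneg hy.1 (by linarith [hy.2])
      have hc : (1 - 2 * y) ^ 2 = 1 - 4 * (y * (1 - y)) := by ring
      have hcc : (1 - 2 * y) ^ 2 ≤ 1 := by nlinarith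
      set θ := y * (1 - y)
      set b := 1 - 2 * y
      have hp : 0 ≤ θ ^ a := pow_nonneg hθ0 a
      have hA : (0:ℝ) ≤ a := Nat.cast_nonneg a
      have hA2 : (a:ℝ) ≤ 2 := by exact_mod_cast ha
      have main : g y ^ 2 - 2 * ((((a:ℝ) + 1) - (4 * a + 6) * θ) * g y ^ 2
          + θ * b * (2 * g y * g' y)) ≤ 400 * (θ ^ 2 * g y ^ 2 + θ ^ 2 * g' y ^ 2) := by
        have e1 : 2 * (4 * a + 6) * θ * g y ^ 2 ≤ (1/2 + 392 * θ ^ 2) * g y ^ 2 := by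
          apply mul_le_mul_of_nonneg_right _ (sq_nonneg _)
          nlinarith [sq_nonneg (28 * θ - 1), mul_nonneg (sub_nonneg.2 hA2) hθ0]
        have e2 : -(4 * θ * b * g y * g' y) ≤ (1/2) * g y ^ 2 + 8 * θ ^ 2 * g' y ^ 2 := by
          have : b ^ 2 * g y ^ 2 ≤ 1 * g y ^ 2 := mul_le_mul_of_nonneg_right hcc (sq_nonneg _)
          nlinarith [sq_nonneg (b * g y + 4 * θ * g' y)]
        have e3 : 0 ≤ (a:ℝ) * g y ^ 2 := by positivity
        have e4 : 0 ≤ θ ^ 2 * g' y ^ 2 := by positivity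
        have e5 : 0 ≤ θ ^ 2 * g y ^ 2 := by positivity
        nlinarith
      have := mul_le_mul_of_nonneg_left main hp
      calc _ = θ ^ a * (g y ^ 2 - 2 * ((((a:ℝ) + 1) - (4 * a + 6) * θ) * g y ^ 2
          + θ * b * (2 * g y * g' y))) := by simp only [hφ']; ring
        _ ≤ _ := this
        _ = _ := by ring
  rw [intervalIntegral.integral_sub, intervalIntegral.integral_const_mul, hzero] at key
  · simpa using key
  · exact (by fun_prop : Continuous _).intervalIntegrable _ _
  · exact (by fun_prop : Continuous _).intervalIntegrable _ _

/-- two-dimensional Hardy inequality in the normal variable -/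
lemma hardy2 (a : ℕ) (ha : a ≤ 2) {g g' : ℝ × ℝ → ℝ}
    (hg : ∀ x y, HasDerivAt (fun s => g (x, s)) (g' (x, y)) y)
    (hgc : Continuous g) (hg' : Continuous g') :
    ∫ x in Oset, (x.2 * (1 - x.2)) ^ a * g x ^ 2 ≤
      400 * ((∫ x in Oset, (x.2 * (1 - x.2)) ^ (a + 2) * g x ^ 2)
        + ∫ x in Oset, (x.2 * (1 - x.2)) ^ (a + 2) * g' x ^ 2) := by
  rw [← integral_add (intgO (by fun_prop)) (intgO (by fun_prop)), ← integral_const_mul,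
    intO (by fun_prop), intO (by fun_prop)]
  apply intervalIntegral.integral_mono_on zero_le_one
  · exact (cont_inner (f := fun x => (x.2 * (1 - x.2)) ^ a * g x ^ 2)
      (by fun_prop)).intervalIntegrable _ _
  · exact (cont_inner (f := fun x => 400 * ((x.2 * (1 - x.2)) ^ (a + 2) * g x ^ 2 +
      (x.2 * (1 - x.2)) ^ (a + 2) * g' x ^ 2)) (by fun_prop)).intervalIntegrable _ _
  · intro x _
    exact hardy1 a ha (hg x) (by fun_prop)

/-- one-dimensional Sobolev inequality -/
lemma sob1 {g g' : ℝ → ℝ} (hg : ∀ y, HasDerivAt g (g' y) y) (hg' : Continuous g')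
    {y : ℝ} (hy : y ∈ Set.Icc (0:ℝ) 1) :
    g y ^ 2 ≤ ∫ s in (0:ℝ)..1, 2 * (g s ^ 2 + g' s ^ 2) := by
  have hgc : Continuous g := continuous_iff_continuousAt.2 fun y => (hg y).continuousAt
  set I := ∫ s in (0:ℝ)..1, (g s ^ 2 + g' s ^ 2) with hI
  have hc : Continuous fun s => g s ^ 2 + g' s ^ 2 := by fun_prop
  have hstep : ∀ s ∈ Set.Icc (0:ℝ) 1, g y ^ 2 ≤ g s ^ 2 + I := by
    intro s hs
    have h1 : ∫ r in s..y, 2 * g r * g' r = g y ^ 2 - g s ^ 2 := by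
      apply intervalIntegral.integral_eq_sub_of_hasDerivAt (f := fun r => g r ^ 2)
      · intro r _
        exact ((hg r).pow 2).congr_deriv (by simp)
      · exact (by fun_prop : Continuous _).intervalIntegrable _ _
    have h2 : |∫ r in s..y, 2 * g r * g' r| ≤ I := by
      have h3 : ‖∫ r in s..y, 2 * g r * g' r‖ ≤ |∫ r in s..y, (g r ^ 2 + g' r ^ 2)| := by
        apply intervalIntegral.norm_integral_le_abs_of_norm_le
        · refine Filter.Eventually.of_forall fun r => ?_
          rw [Real.norm_eq_abs, abs_le]
          constructor <;> nlinarith [sq_nonneg (g r + g' r), sq_nonneg (g r - g' r)]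
        · exact hc.intervalIntegrable _ _
      refine h3.trans ?_
      rw [hI]
      have h0 : 0 ≤ ∫ s in (0:ℝ)..1, (g s ^ 2 + g' s ^ 2) :=
        intervalIntegral.integral_nonneg zero_le_one fun r _ => by positivity
      rw [← abs_of_nonneg h0]
      apply intervalIntegral.abs_integral_mono_interval
      · rw [Set.uIoc, Set.uIoc]
        apply Set.Ioc_subset_Ioc
        · simp only [min_eq_left (zero_le_one' ℝ)]; exact le_min hs.1 hy.1
        · simp only [max_eq_right (zero_le_one' ℝ)]; exact max_le hs.2 hy.2
      · exact Filter.Eventually.of_forall fun r => by simp only [Pi.zero_apply]; positivity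
      · exact hc.intervalIntegrable _ _
    linarith [le_abs_self (∫ r in s..y, 2 * g r * g' r)]
  have h5 : ∫ s in (0:ℝ)..1, g y ^ 2 ≤ ∫ s in (0:ℝ)..1, (g s ^ 2 + I) := by
    apply intervalIntegral.integral_mono_on zero_le_one _ _ hstep
    · exact (by fun_prop : Continuous _).intervalIntegrable _ _
    · exact (by fun_prop : Continuous _).intervalIntegrable _ _
  have h6 : ∫ s in (0:ℝ)..1, g s ^ 2 ≤ I := by
    apply intervalIntegral.integral_mono_on zero_le_one
    · exact (by fun_prop : Continuous _).intervalIntegrable _ _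
    · exact hc.intervalIntegrable _ _
    · intro s _; nlinarith [sq_nonneg (g' s)]
  rw [intervalIntegral.integral_add ((by fun_prop : Continuous _).intervalIntegrable _ _)
    ((by fun_prop : Continuous _).intervalIntegrable _ _)] at h5
  simp at h5
  rw [intervalIntegral.integral_const_mul]
  linarith

/-- two-dimensional Sobolev inequality -/
lemma sob2 {u u1 u2 u12 : ℝ × ℝ → ℝ}
    (h1 : ∀ x y, HasDerivAt (fun s => u (s, y)) (u1 (x, y)) x)
    (h2 : ∀ x y, HasDerivAt (fun s => u (x, s)) (u2 (x, y)) y)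
    (h12 : ∀ x y, HasDerivAt (fun s => u1 (x, s)) (u12 (x, y)) y)
    (c : Continuous u) (c1 : Continuous u1) (c2 : Continuous u2) (c12 : Continuous u12)
    {x : ℝ × ℝ} (hx : x ∈ Oset) :
    u x ^ 2 ≤ 4 * ((∫ x in Oset, u x ^ 2) + (∫ x in Oset, u2 x ^ 2)
      + (∫ x in Oset, u1 x ^ 2) + ∫ x in Oset, u12 x ^ 2) := by
  obtain ⟨p, q⟩ := x
  have hp : p ∈ Set.Icc (0:ℝ) 1 := Set.Ioo_subset_Icc_self hx.1
  have hq : q ∈ Set.Icc (0:ℝ) 1 := Set.Ioo_subset_Icc_self hx.2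
  rw [← integral_add (intgO (by fun_prop)) (intgO (by fun_prop)),
    ← integral_add (intgO (by fun_prop)) (intgO (by fun_prop)),
    ← integral_add (intgO (by fun_prop)) (intgO (by fun_prop)), ← integral_const_mul,
    intO (by fun_prop)]
  refine (sob1 (g := fun s => u (s, q)) (fun s => h1 s q) (by fun_prop) hp).trans ?_
  apply intervalIntegral.integral_mono_on zero_le_one
  · exact (by fun_prop : Continuous _).intervalIntegrable _ _
  · exact (cont_inner (f := fun a => 4 * (u a ^ 2 + u2 a ^ 2 + u1 a ^ 2 + u12 a ^ 2))
      (by fun_prop)).intervalIntegrable _ _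
  · intro s _
    have A := sob1 (g := fun r => u (s, r)) (fun r => h2 s r) (by fun_prop) hq
    have B := sob1 (g := fun r => u1 (s, r)) (fun r => h12 s r) (by fun_prop) hq
    have hAB := add_le_add A B
    rw [← intervalIntegral.integral_add ((by fun_prop : Continuous _).intervalIntegrable _ _)
      ((by fun_prop : Continuous _).intervalIntegrable _ _)] at hAB
    have h7 := mul_le_mul_of_nonneg_left hAB (zero_le_two (α := ℝ))
    rw [← intervalIntegral.integral_const_mul] at h7
    refine h7.trans (le_of_eq ?_)
    congr 1
    funext r
    ring

/-- mixed derivatives -/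
def WW (w : ℝ × ℝ → F) (k l : ℕ) : ℝ × ℝ → F := pd1^[k] (pd2^[l] w)

lemma WW_cd {w : ℝ × ℝ → F} (hw : ContDiff ℝ ∞ w) (k l : ℕ) : ContDiff ℝ ∞ (WW w k l) :=
  cd_pd1_iter (cd_pd2_iter hw l) k

lemma WW_x {w : ℝ × ℝ → F} (hw : ContDiff ℝ ∞ w) (k l : ℕ) (x y : ℝ) :
    HasDerivAt (fun s => WW w k l (s, y)) (WW w (k + 1) l (x, y)) x := by
  have := hasDeriv_x (WW_cd hw k l) x y
  rwa [WW, WW, Function.iterate_succ_apply']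

lemma WW_y {w : ℝ × ℝ → F} (hw : ContDiff ℝ ∞ w) (k l : ℕ) (x y : ℝ) :
    HasDerivAt (fun s => WW w k l (x, s)) (WW w k (l + 1) (x, y)) y := by
  have := hasDeriv_y (WW_cd hw k l) x y
  rw [WW, pd_comm_iter (cd_pd2_iter hw l)] at this
  rwa [WW, WW, Function.iterate_succ_apply']

/-- the sup bound for a component, given weighted bounds -/
lemma comp_bound {w : ℝ × ℝ → ℝ × ℝ} (hw : ContDiff ℝ ∞ w) (L : ℝ × ℝ →L[ℝ] ℝ)
    (hL : ∀ z, |L z| ≤ ‖z‖) {M : ℝ} (hM : 0 ≤ M)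
    (h0 : ∀ k, k = 1 ∨ k = 2 → ∫ x in Oset, (x.2 * (1 - x.2)) ^ 2 * ‖WW w k 0 x‖ ^ 2 ≤ M)
    (h1 : ∀ k ≤ 2, ∫ x in Oset, (x.2 * (1 - x.2)) ^ 2 * ‖WW w k 1 x‖ ^ 2 ≤ M)
    (h2 : ∀ k ≤ 2, ∫ x in Oset, (x.2 * (1 - x.2)) ^ 2 * ‖WW w k 2 x‖ ^ 2 ≤ M)
    (h3 : ∀ k ≤ 1, ∫ x in Oset, (x.2 * (1 - x.2)) ^ 4 * ‖WW w k 3 x‖ ^ 2 ≤ M)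
    (h4 : ∀ k ≤ 1, ∫ x in Oset, (x.2 * (1 - x.2)) ^ 4 * ‖WW w k 4 x‖ ^ 2 ≤ M)
    {x : ℝ × ℝ} (hx : x ∈ Oset) :
    L (WW w 1 0 x) ^ 2 ≤ 10000000 * M ∧ L (WW w 0 1 x) ^ 2 ≤ 10000000 * M := by
  have hc : ∀ k l, Continuous (WW w k l) := fun k l => (WW_cd hw k l).continuous
  have hcL : ∀ k l, Continuous fun x => L (WW w k l x) := fun k l => L.continuous.comp (hc k l)
  have hdx : ∀ k l x y, HasDerivAt (fun s => L (WW w k l (s, y))) (L (WW w (k+1) l (x, y))) x :=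
    fun k l x y => L.hasFDerivAt.comp_hasDerivAt x (WW_x hw k l x y)
  have hdy : ∀ k l x y, HasDerivAt (fun s => L (WW w k l (x, s))) (L (WW w k (l+1) (x, y))) y :=
    fun k l x y => L.hasFDerivAt.comp_hasDerivAt y (WW_y hw k l x y)
  have red : ∀ (m k l : ℕ) (R : ℝ),
      ∫ x in Oset, (x.2 * (1 - x.2)) ^ m * ‖WW w k l x‖ ^ 2 ≤ R →
      ∫ x in Oset, (x.2 * (1 - x.2)) ^ m * L (WW w k l x) ^ 2 ≤ R := by
    intro m k l R h
    have hck := hc k l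
    refine le_trans ?_ h
    apply setIntegral_mono_on (intgO (by fun_prop)) (intgO (by fun_prop)) measO
    intro z hz
    have hz2 : 0 < z.2 * (1 - z.2) := mul_pos hz.2.1 (by linarith [hz.2.2])
    apply mul_le_mul_of_nonneg_left _ (pow_nonneg hz2.le m)
    rw [← sq_abs]
    exact pow_le_pow_left₀ (abs_nonneg _) (hL _) 2
  have L2 : ∀ (k l : ℕ) (R : ℝ),
      ∫ x in Oset, (x.2 * (1 - x.2)) ^ 2 * L (WW w k l x) ^ 2 ≤ R →
      ∫ x in Oset, (x.2 * (1 - x.2)) ^ 2 * L (WW w k (l + 1) x) ^ 2 ≤ R →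
      ∫ x in Oset, L (WW w k l x) ^ 2 ≤ 800 * R := by
    intro k l R hA hB
    have := hardy2 0 (by norm_num) (hdy k l) (hcL k l) (hcL k (l+1))
    simp only [pow_zero, one_mul, zero_add] at this
    linarith
  have g3 : ∀ k ≤ 1, ∫ x in Oset, (x.2 * (1 - x.2)) ^ 2 * L (WW w k 3 x) ^ 2 ≤ 800 * M := by
    intro k hk
    have := hardy2 2 (by norm_num) (hdy k 3) (hcL k 3) (hcL k 4)
    simp only [Nat.reduceAdd] at this
    linarith [red _ _ _ _ (h3 k hk), red _ _ _ _ (h4 k hk)]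
  have f2 : ∀ k ≤ 1, ∫ x in Oset, L (WW w k 2 x) ^ 2 ≤ 800 * (800 * M) := fun k hk =>
    L2 k 2 _ ((red _ _ _ _ (h2 k (by omega))).trans (by linarith)) (g3 k hk)
  have f1 : ∀ k ≤ 2, ∫ x in Oset, L (WW w k 1 x) ^ 2 ≤ 800 * M := fun k hk =>
    L2 k 1 _ (red _ _ _ _ (h1 k hk)) (red _ _ _ _ (h2 k hk))
  have f0 : ∀ k, k = 1 ∨ k = 2 → ∫ x in Oset, L (WW w k 0 x) ^ 2 ≤ 800 * M := fun k hk =>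
    L2 k 0 _ (red _ _ _ _ (h0 k hk)) (red _ _ _ _ (h1 k (by omega)))
  constructor
  · have := sob2 (hdx 1 0) (hdy 1 0) (hdy 2 0) (hcL _ _) (hcL _ _) (hcL _ _) (hcL _ _) hx
    simp only [Nat.reduceAdd] at this
    linarith [f0 1 (by simp), f0 2 (by simp), f1 1 (by simp), f1 2 (by simp)]
  · have := sob2 (hdx 0 1) (hdy 0 1) (hdy 1 1) (hcL _ _) (hcL _ _) (hcL _ _) (hcL _ _) hx
    simp only [Nat.reduceAdd] at this
    linarith [f1 0 (by simp), f1 1 (by simp), f2 0 (by simp), f2 1 (by simp)]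

lemma pdt_smooth {v : ℝ → ℝ × ℝ → ℝ × ℝ} (hv : SmoothT v) : SmoothT (pdt v) := by
  have h : ContDiff ℝ ∞ (fun p : ℝ × (ℝ × ℝ) => v p.1 p.2) := contDiff_infty.2 hv
  have h2 : (fun p : ℝ × (ℝ × ℝ) => pdt v p.1 p.2) =
      fun p => fderiv ℝ (fun p : ℝ × (ℝ × ℝ) => v p.1 p.2) p (1, 0) := by
    funext p
    have a1 : HasFDerivAt (fun p : ℝ × (ℝ × ℝ) => v p.1 p.2) _ (p.1, p.2) :=
      (h.differentiable (by simp) _).hasFDerivAt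
    have a2 : HasDerivAt (fun s : ℝ => (s, p.2)) ((1 : ℝ), (0 : ℝ × ℝ)) p.1 :=
      (hasDerivAt_id _).prodMk (hasDerivAt_const _ _)
    exact (a1.comp_hasDerivAt p.1 a2).deriv
  unfold SmoothT
  rw [h2]
  exact contDiff_infty.1 ((h.fderiv_right (m := ∞) (by simp)).clm_apply contDiff_const)

lemma slice_smooth {v : ℝ → ℝ × ℝ → ℝ × ℝ} (hv : SmoothT v) (t : ℝ) : ContDiff ℝ ∞ (v t) :=
  (contDiff_infty.2 hv).comp (contDiff_const.prodMk contDiff_id)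

lemma pdt_iter_smooth {v : ℝ → ℝ × ℝ → ℝ × ℝ} (hv : SmoothT v) (l : ℕ) :
    SmoothT (pdt^[l] v) := by
  induction l with
  | zero => exact hv
  | succ k ih => rw [Function.iterate_succ_apply']; exact pdt_smooth ih

end Helpers

/-- (Lemma 3.4.) `‖∂ₜDv(t)‖_{L^∞(Ω)} ≤ C E(t,v)^{1/2}`. -/
theorem stmt3 (C₁ C₂ : ℝ) (hC₁ : 0 < C₁) (hC₁₂ : C₁ ≤ C₂) :
    ∃ C > (0:ℝ),
      ∀ ρ₀ : ℝ × ℝ → ℝ, IsDensity C₁ C₂ ρ₀ →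
        ∀ T : ℝ, 0 ≤ T →
          ∀ v : ℝ → ℝ × ℝ → ℝ × ℝ, SmoothT v → PerT v →
            ∀ t ∈ Set.Icc (0:ℝ) T,
              ∀ x ∈ Oset, ‖iteratedFDeriv ℝ 1 (pdt v t) x‖ ≤ C * Real.sqrt (energy ρ₀ v t) := by
  obtain ⟨c, hc0, hc1, hcC⟩ : ∃ c : ℝ, 0 < c ∧ c ≤ 1 ∧ c ≤ C₁ :=
    ⟨min C₁ 1, lt_min hC₁ one_pos, min_le_right _ _, min_le_left _ _⟩
  refine ⟨2 * Real.sqrt (10000000 * (c ^ 4)⁻¹), by positivity, ?_⟩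
  intro ρ₀ hρ T _ v hv _ t _ x hx
  set E := energy ρ₀ v t with hE
  have hρc : Continuous ρ₀ := (hρ.1 0).continuous
  have hth : ∀ z ∈ Oset, 0 < z.2 * (1 - z.2) ∧ z.2 * (1 - z.2) ≤ 1 := by
    intro z hz
    obtain ⟨_, h1, h2⟩ := hz
    exact ⟨mul_pos h1 (by linarith), by nlinarith⟩
  have hρθ : ∀ z ∈ Oset, c * (z.2 * (1 - z.2)) ≤ ρ₀ z := by
    intro z hz
    have h := (hρ.2.2.2 z hz).1
    have h3 := hth z hz
    obtain ⟨_, h1, h2⟩ := hz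
    have h4 : z.2 * (1 - z.2) ≤ distG z := le_min (by nlinarith) (by nlinarith)
    calc c * (z.2 * (1 - z.2)) ≤ C₁ * (z.2 * (1 - z.2)) :=
          mul_le_mul_of_nonneg_right hcC h3.1.le
      _ ≤ C₁ * distG z := mul_le_mul_of_nonneg_left h4 hC₁.le
      _ ≤ _ := h
  have hρ0 : ∀ z ∈ Oset, 0 ≤ ρ₀ z := fun z hz =>
    (mul_nonneg hc0.le (hth z hz).1.le).trans (hρθ z hz)
  have hw : ContDiff ℝ ((⊤ : ℕ∞) : WithTop ℕ∞) (pdt v t) := slice_smooth (pdt_smooth hv) t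
  set w := pdt v t with hwdef
  -- weight comparison
  have wt : ∀ m n : ℕ, m ≤ n → m ≤ 4 → ∀ z ∈ Oset,
      c ^ 4 * (z.2 * (1 - z.2)) ^ n ≤ ρ₀ z ^ m := by
    intro m n hmn hm z hz
    have h3 := hth z hz
    calc c ^ 4 * (z.2 * (1 - z.2)) ^ n ≤ c ^ m * (z.2 * (1 - z.2)) ^ m :=
          mul_le_mul (pow_le_pow_of_le_one hc0.le hc1 hm)
            (pow_le_pow_of_le_one h3.1.le h3.2 hmn) (pow_nonneg h3.1.le n) (by positivity)
      _ = (c * (z.2 * (1 - z.2))) ^ m := (mul_pow _ _ _).symm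
      _ ≤ _ := pow_le_pow_left₀ (mul_nonneg hc0.le h3.1.le) (hρθ z hz) m
  -- nonnegativity of the energy pieces
  have hn1 : ∀ l₀, 0 ≤ ∫ x in Oset, ρ₀ x * ‖(pdt^[l₀] v) t x‖ ^ 2 := fun l₀ =>
    setIntegral_nonneg measO fun z hz => mul_nonneg (hρ0 z hz) (by positivity)
  have hn2 : ∀ l₀ l₁, 0 ≤ ∫ x in Oset, ρ₀ x *
      (gradSq (pd1^[l₁] ((pdt^[l₀] v) t)) x + gradSq (pd1^[l₁ + 1] ((pdt^[l₀] v) t)) x) :=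
    fun l₀ l₁ => setIntegral_nonneg measO fun z hz =>
      mul_nonneg (hρ0 z hz) (by unfold gradSq; positivity)
  have hn3 : ∀ l₀ l₁ l₂, 0 ≤ ∫ x in Oset, ρ₀ x ^ l₂ *
      ‖(pd1^[l₁] (pd2^[l₂] ((pdt^[l₀] v) t))) x‖ ^ 2 :=
    fun l₀ l₁ l₂ => setIntegral_nonneg measO fun z hz =>
      mul_nonneg (pow_nonneg (hρ0 z hz) _) (by positivity)
  have hS1 : 0 ≤ ∑ l₀ ∈ Finset.range 5, ∫ x in Oset, ρ₀ x * ‖(pdt^[l₀] v) t x‖ ^ 2 :=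
    Finset.sum_nonneg fun l₀ _ => hn1 l₀
  have hS2 : 0 ≤ ∑ l₀ ∈ Finset.range 4, ∑ l₁ ∈ Finset.range (7 - 2 * l₀),
        ∫ x in Oset, ρ₀ x *
          (gradSq (pd1^[l₁] ((pdt^[l₀] v) t)) x + gradSq (pd1^[l₁ + 1] ((pdt^[l₀] v) t)) x) :=
    Finset.sum_nonneg fun l₀ _ => Finset.sum_nonneg fun l₁ _ => hn2 l₀ l₁
  have hS3 : 0 ≤ ∑ l₀ ∈ Finset.range 4, ∑ l₁ ∈ Finset.range (7 - 2 * l₀),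
        ∑ l₂ ∈ Finset.Icc 2 (8 - 2 * l₀ - l₁),
          ∫ x in Oset, ρ₀ x ^ l₂ * ‖(pd1^[l₁] (pd2^[l₂] ((pdt^[l₀] v) t))) x‖ ^ 2 :=
    Finset.sum_nonneg fun l₀ _ => Finset.sum_nonneg fun l₁ _ =>
      Finset.sum_nonneg fun l₂ _ => hn3 l₀ l₁ l₂
  have hE0 : 0 ≤ E := by rw [hE, energy]; linarith
  have eB : ∀ l₁ ≤ 4, ∫ x in Oset, ρ₀ x * (gradSq (pd1^[l₁] w) x + gradSq (pd1^[l₁ + 1] w) x)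
      ≤ E := by
    intro l₁ hl
    have a1 := Finset.single_le_sum (f := fun l₁ => ∫ x in Oset, ρ₀ x *
      (gradSq (pd1^[l₁] ((pdt^[1] v) t)) x + gradSq (pd1^[l₁ + 1] ((pdt^[1] v) t)) x))
      (s := Finset.range (7 - 2 * 1)) (fun i _ => hn2 1 i)
      (Finset.mem_range.2 (by omega : l₁ < 7 - 2 * 1))
    have a2 := Finset.single_le_sum (f := fun l₀ => ∑ l₁ ∈ Finset.range (7 - 2 * l₀),
        ∫ x in Oset, ρ₀ x *
          (gradSq (pd1^[l₁] ((pdt^[l₀] v) t)) x + gradSq (pd1^[l₁ + 1] ((pdt^[l₀] v) t)) x))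
      (s := Finset.range 4) (fun l₀ _ => Finset.sum_nonneg fun i _ => hn2 l₀ i)
      (Finset.mem_range.2 (by norm_num : 1 < 4))
    have a3 := a1.trans a2
    have a4 := a3.trans (by rw [hE, energy]; linarith : _ ≤ E)
    exact a4
  have eC : ∀ l₁ l₂, 2 ≤ l₂ → l₁ + l₂ ≤ 6 →
      ∫ x in Oset, ρ₀ x ^ l₂ * ‖WW w l₁ l₂ x‖ ^ 2 ≤ E := by
    intro l₁ l₂ h2 h6
    have a0 := Finset.single_le_sum (f := fun l₂ => ∫ x in Oset, ρ₀ x ^ l₂ *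
      ‖(pd1^[l₁] (pd2^[l₂] ((pdt^[1] v) t))) x‖ ^ 2)
      (s := Finset.Icc 2 (8 - 2 * 1 - l₁)) (fun i _ => hn3 1 l₁ i)
      (Finset.mem_Icc.2 ⟨h2, (by omega : l₂ ≤ 8 - 2 * 1 - l₁)⟩)
    have a1 := Finset.single_le_sum (f := fun l₁ => ∑ l₂ ∈ Finset.Icc 2 (8 - 2 * 1 - l₁),
      ∫ x in Oset, ρ₀ x ^ l₂ * ‖(pd1^[l₁] (pd2^[l₂] ((pdt^[1] v) t))) x‖ ^ 2)
      (s := Finset.range (7 - 2 * 1))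
      (fun i _ => Finset.sum_nonneg fun j _ => hn3 1 i j)
      (Finset.mem_range.2 (by omega : l₁ < 7 - 2 * 1))
    have a2 := Finset.single_le_sum (f := fun l₀ => ∑ l₁ ∈ Finset.range (7 - 2 * l₀),
        ∑ l₂ ∈ Finset.Icc 2 (8 - 2 * l₀ - l₁),
          ∫ x in Oset, ρ₀ x ^ l₂ * ‖(pd1^[l₁] (pd2^[l₂] ((pdt^[l₀] v) t))) x‖ ^ 2)
      (s := Finset.range 4)
      (fun l₀ _ => Finset.sum_nonneg fun i _ => Finset.sum_nonneg fun j _ => hn3 l₀ i j)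
      (Finset.mem_range.2 (by norm_num : 1 < 4))
    exact ((a0.trans a1).trans a2).trans (by rw [hE, energy]; linarith : _ ≤ E)
  have hWc : ∀ k l, Continuous (WW w k l) := fun k l => (WW_cd hw k l).continuous
  -- transfer
  have tr : ∀ (n k l : ℕ) (G : ℝ × ℝ → ℝ), Continuous G → ∫ x in Oset, G x ≤ E →
      (∀ z ∈ Oset, c ^ 4 * (z.2 * (1 - z.2)) ^ n * ‖WW w k l z‖ ^ 2 ≤ G z) →
      ∫ x in Oset, (x.2 * (1 - x.2)) ^ n * ‖WW w k l x‖ ^ 2 ≤ (c ^ 4)⁻¹ * E := by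
    intro n k l G hG hGE hle
    have hWkl := hWc k l
    rw [le_inv_mul_iff₀ (by positivity), ← integral_const_mul]
    refine le_trans ?_ hGE
    apply setIntegral_mono_on (intgO (by fun_prop)) (intgO hG) measO
    intro z hz
    rw [← mul_assoc]
    exact hle z hz
  have cB : ∀ k, Continuous fun x => ρ₀ x * (gradSq (pd1^[k] w) x + gradSq (pd1^[k + 1] w) x) := by
    intro k
    have b1 := (cd_pd1 (cd_pd1_iter hw k)).continuous
    have b2 := (cd_pd2 (cd_pd1_iter hw k)).continuous
    have b3 := (cd_pd1 (cd_pd1_iter hw (k + 1))).continuous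
    have b4 := (cd_pd2 (cd_pd1_iter hw (k + 1))).continuous
    unfold gradSq
    fun_prop
  have B0 : ∀ k, k ≤ 4 →
      ∫ x in Oset, (x.2 * (1 - x.2)) ^ 2 * ‖WW w (k + 1) 0 x‖ ^ 2 ≤ (c ^ 4)⁻¹ * E := by
    intro k hk
    refine tr 2 (k + 1) 0 _ (cB k) (eB k hk) fun z hz => ?_
    have hwt := wt 1 2 (by norm_num) (by norm_num) z hz
    rw [pow_one] at hwt
    have e : WW w (k + 1) 0 z = pd1 (pd1^[k] w) z := by
      rw [WW, Function.iterate_succ_apply']; rfl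
    rw [e]
    apply mul_le_mul hwt _ (by positivity) (hρ0 z hz)
    unfold gradSq
    nlinarith [sq_nonneg ‖pd2 (pd1^[k] w) z‖, sq_nonneg ‖pd1 (pd1^[k + 1] w) z‖,
      sq_nonneg ‖pd2 (pd1^[k + 1] w) z‖]
  have B1 : ∀ k, k ≤ 4 →
      ∫ x in Oset, (x.2 * (1 - x.2)) ^ 2 * ‖WW w k 1 x‖ ^ 2 ≤ (c ^ 4)⁻¹ * E := by
    intro k hk
    refine tr 2 k 1 _ (cB k) (eB k hk) fun z hz => ?_
    have hwt := wt 1 2 (by norm_num) (by norm_num) z hz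
    rw [pow_one] at hwt
    have e : WW w k 1 z = pd2 (pd1^[k] w) z := by
      rw [WW, pd_comm_iter hw]; rfl
    rw [e]
    apply mul_le_mul hwt _ (by positivity) (hρ0 z hz)
    unfold gradSq
    nlinarith [sq_nonneg ‖pd1 (pd1^[k] w) z‖, sq_nonneg ‖pd1 (pd1^[k + 1] w) z‖,
      sq_nonneg ‖pd2 (pd1^[k + 1] w) z‖]
  have Cc : ∀ n k l, 2 ≤ l → l ≤ 4 → l ≤ n → k + l ≤ 6 →
      ∫ x in Oset, (x.2 * (1 - x.2)) ^ n * ‖WW w k l x‖ ^ 2 ≤ (c ^ 4)⁻¹ * E := by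
    intro n k l h2 h4 hn h6
    have hWkl := hWc k l
    refine tr n k l (fun x => ρ₀ x ^ l * ‖WW w k l x‖ ^ 2) (by fun_prop) (eC k l h2 h6)
      fun z hz => ?_
    exact mul_le_mul_of_nonneg_right (wt l n hn h4 z hz) (by positivity)
  have hM : 0 ≤ (c ^ 4)⁻¹ * E := by positivity
  have CB : ∀ L : ℝ × ℝ →L[ℝ] ℝ, (∀ z, |L z| ≤ ‖z‖) →
      L (WW w 1 0 x) ^ 2 ≤ 10000000 * ((c ^ 4)⁻¹ * E) ∧
      L (WW w 0 1 x) ^ 2 ≤ 10000000 * ((c ^ 4)⁻¹ * E) := by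
    intro L hL
    refine comp_bound hw L hL hM ?_ ?_ ?_ ?_ ?_ hx
    · rintro k (rfl | rfl)
      · exact B0 0 (by norm_num)
      · exact B0 1 (by norm_num)
    · intro k hk; exact B1 k (by omega)
    · intro k hk; exact Cc 2 k 2 (by omega) (by omega) (by omega) (by omega)
    · intro k hk; exact Cc 4 k 3 (by omega) (by omega) (by omega) (by omega)
    · intro k hk; exact Cc 4 k 4 (by omega) (by omega) (by omega) (by omega)
  have F1 := CB (ContinuousLinearMap.fst ℝ ℝ ℝ) (fun z => norm_fst_le z)
  have F2 := CB (ContinuousLinearMap.snd ℝ ℝ ℝ) (fun z => norm_snd_le z)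
  set S := Real.sqrt (10000000 * (c ^ 4)⁻¹) * Real.sqrt E with hS
  have hSS : Real.sqrt (10000000 * ((c ^ 4)⁻¹ * E)) = S := by
    rw [← mul_assoc, Real.sqrt_mul (by positivity)]
  have hnorm : ∀ z : ℝ × ℝ, z.1 ^ 2 ≤ 10000000 * ((c ^ 4)⁻¹ * E) →
      z.2 ^ 2 ≤ 10000000 * ((c ^ 4)⁻¹ * E) → ‖z‖ ≤ S := by
    intro z h1 h2
    rw [← hSS]
    exact max_le (Real.abs_le_sqrt h1) (Real.abs_le_sqrt h2)
  have G1 : ‖pd1 w x‖ ≤ S := hnorm _ F1.1 F2.1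
  have G2 : ‖pd2 w x‖ ≤ S := hnorm _ F1.2 F2.2
  have hS0 : 0 ≤ S := by positivity
  rw [norm_iteratedFDeriv_one]
  have : 2 * Real.sqrt (10000000 * (c ^ 4)⁻¹) * Real.sqrt E = 2 * S := by rw [hS]; ring
  rw [this]
  refine ContinuousLinearMap.opNorm_le_bound _ (by positivity) fun h => ?_
  have hdec : fderiv ℝ w x h = h.1 • pd1 w x + h.2 • pd2 w x := by
    rw [pd1, pd2, ← map_smul, ← map_smul, ← map_add]
    congr 1
    ext <;> simp
  rw [hdec]
  calc _ ≤ ‖h.1 • pd1 w x‖ + ‖h.2 • pd2 w x‖ := norm_add_le _ _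
    _ = ‖h.1‖ * ‖pd1 w x‖ + ‖h.2‖ * ‖pd2 w x‖ := by rw [norm_smul, norm_smul]
    _ ≤ ‖h‖ * S + ‖h‖ * S := add_le_add
        (mul_le_mul (norm_fst_le h) G1 (norm_nonneg _) (norm_nonneg _))
        (mul_le_mul (norm_snd_le h) G2 (norm_nonneg _) (norm_nonneg _))
    _ = 2 * S * ‖h‖ := by ring
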